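/- arXiv:1305.1490 — 2 statements merged into one kernel-verified Lean document; each statement's English description precedes it below -/
import Mathlib

section
/- Let A and B be Hermitian positive semidefinite n × n complex matrices. Then det(I_n + A + B) ≤ det(I_n + A) · det(I_n + B), where all three determinants are real and positive since the matrices I_n + A, I_n + B and I_n + A + B are Hermitian positive definite. -/
open scoped ComplexOrder

namespace Matrix

variable {n : Type*} [Fintype n]

open scoped MatrixOrder in
theorem PosSemidef.exists_eq_conjTranspose_mul_self {A : Matrix n n ℂ} (hA : A.PosSemidef) :
    ∃ C : Matrix n n ℂ, A = Cᴴ * C := by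
  classical
  exact CStarAlgebra.nonneg_iff_eq_star_mul_self.mp hA.nonneg

variable [DecidableEq n]

theorem PosSemidef.one_le_det_one_add {A : Matrix n n ℂ} (hA : A.PosSemidef) :
    1 ≤ (1 + A).det := by
  let U := hA.1.eigenvectorUnitary
  let D : Matrix n n ℂ := diagonal (fun i => (hA.1.eigenvalues i : ℂ))
  have hspec : A = (U : Matrix n n ℂ) * D * star (U : Matrix n n ℂ) := by
    have h := hA.1.spectral_theorem
    rw [Unitary.conjStarAlgAut_apply] at h
    exact h
  have hdet : (1 + A).det = ∏ i, (1 + (hA.1.eigenvalues i : ℂ)) := by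
    rw [congrArg (fun X => (1 + X).det) hspec, mul_assoc, det_one_add_mul_comm,
      mul_assoc, Unitary.coe_star_mul_self, mul_one, ← diagonal_one, diagonal_add, det_diagonal]
  rw [hdet]
  have h : (1 : ℝ) ≤ ∏ i, (1 + hA.1.eigenvalues i) :=
    Finset.univ.one_le_prod fun i _ => le_add_of_nonneg_right (hA.eigenvalues_nonneg i)
  exact_mod_cast h

theorem PosDef.det_add_conjTranspose_mul_self {M : Matrix n n ℂ} (hM : M.PosDef)
    (C : Matrix n n ℂ) : (M + Cᴴ * C).det = M.det * (1 + C * M⁻¹ * Cᴴ).det := by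
  have hu : IsUnit M.det := (isUnit_iff_isUnit_det M).mp hM.isUnit
  rw [mul_assoc, det_one_add_mul_comm, ← det_mul, mul_add, mul_one, mul_assoc M⁻¹,
    mul_nonsing_inv_cancel_left _ _ hu]

theorem PosDef.det_le_det_add {M N : Matrix n n ℂ} (hM : M.PosDef) (hN : N.PosSemidef) :
    M.det ≤ (M + N).det := by
  obtain ⟨C, rfl⟩ := hN.exists_eq_conjTranspose_mul_self
  rw [hM.det_add_conjTranspose_mul_self]
  exact le_mul_of_one_le_right hM.det_pos.le
    (hM.inv.posSemidef.mul_mul_conjTranspose_same C).one_le_det_one_add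

theorem PosSemidef.one_sub_inv_one_add {A : Matrix n n ℂ} (hA : A.PosSemidef) :
    (1 - (1 + A)⁻¹).PosSemidef := by
  have hP : (1 + A).PosDef := PosDef.one.add_posSemidef hA
  have hu : IsUnit (1 + A).det := (isUnit_iff_isUnit_det _).mp hP.isUnit
  have h := (hA.add (hA.pow 2)).mul_mul_conjTranspose_same (1 + A)⁻¹
  rw [hP.inv.1.eq] at h
  have hfactor : A + A ^ 2 = A * (1 + A) := by noncomm_ring
  have heq : 1 - (1 + A)⁻¹ = (1 + A)⁻¹ * (A + A ^ 2) * (1 + A)⁻¹ := by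
    rw [hfactor, mul_assoc, mul_assoc, mul_nonsing_inv _ hu, mul_one]
    calc 1 - (1 + A)⁻¹ = (1 + A)⁻¹ * (1 + A) - (1 + A)⁻¹ := by rw [nonsing_inv_mul _ hu]
      _ = (1 + A)⁻¹ * A := by rw [mul_add, mul_one, add_sub_cancel_left]
  rwa [heq]

theorem PosSemidef.det_one_add_add_le {A B : Matrix n n ℂ} (hA : A.PosSemidef)
    (hB : B.PosSemidef) : (1 + A + B).det ≤ (1 + A).det * (1 + B).det := by
  have hP : (1 + A).PosDef := PosDef.one.add_posSemidef hA
  obtain ⟨C, rfl⟩ := hB.exists_eq_conjTranspose_mul_self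
  rw [hP.det_add_conjTranspose_mul_self, det_one_add_mul_comm Cᴴ C]
  refine mul_le_mul_of_nonneg_left ?_ hP.det_pos.le
  have hsplit : 1 + C * Cᴴ = 1 + C * (1 + A)⁻¹ * Cᴴ + C * (1 - (1 + A)⁻¹) * Cᴴ := by
    noncomm_ring
  rw [hsplit]
  exact (PosDef.one.add_posSemidef
    (hP.inv.posSemidef.mul_mul_conjTranspose_same C)).det_le_det_add
    (hA.one_sub_inv_one_add.mul_mul_conjTranspose_same C)

theorem PosDef.det_im_eq_zero_and_det_re_pos {M : Matrix n n ℂ} (hM : M.PosDef) :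
    M.det.im = 0 ∧ 0 < M.det.re :=
  have h := Complex.pos_iff.mp hM.det_pos
  ⟨h.2.symm, h.1⟩

end Matrix

/-- For Hermitian positive semidefinite `n × n` complex matrices `A` and `B`,
the matrices `I + A`, `I + B`, `I + A + B` are Hermitian positive definite, so their
determinants are real and positive, and `det (I + A + B) ≤ det (I + A) * det (I + B)`. -/
theorem stmt_1 {n : ℕ} (A B : Matrix (Fin n) (Fin n) ℂ)
    (hA : A.PosSemidef) (hB : B.PosSemidef) :
    ((1 + A).det.im = 0 ∧ 0 < (1 + A).det.re) ∧
    ((1 + B).det.im = 0 ∧ 0 < (1 + B).det.re) ∧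
    ((1 + A + B).det.im = 0 ∧ 0 < (1 + A + B).det.re) ∧
    (1 + A + B).det.re ≤ (1 + A).det.re * (1 + B).det.re := by
  have hPA : (1 + A).PosDef := Matrix.PosDef.one.add_posSemidef hA
  have hPB : (1 + B).PosDef := Matrix.PosDef.one.add_posSemidef hB
  have hA' := hPA.det_im_eq_zero_and_det_re_pos
  refine ⟨hA', hPB.det_im_eq_zero_and_det_re_pos,
    (hPA.add_posSemidef hB).det_im_eq_zero_and_det_re_pos, ?_⟩
  have h := (Complex.le_def.mp (hA.det_one_add_add_le hB)).1
  rwa [Complex.mul_re, hA'.1, zero_mul, sub_zero] at h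
end

section
/- Let d ≥ 1 and let H_{31}, H_{32}, H_{12}, H_{13}, H_{23}, H_{21} be invertible 2d × 2d complex matrices. Define Y := H_{31}^{−1} H_{32} H_{12}^{−1} H_{13} H_{23}^{−1} H_{21}. Suppose U_1 ∈ ℂ^{2d × d} satisfies Y·U_1 = U_1·Λ for some invertible diagonal d × d matrix Λ, and define U_3 := H_{23}^{−1} H_{21} U_1 and U_2 := H_{12}^{−1} H_{13} U_3. Then the following three equalities of column spaces hold: colspace(H_{31} U_1) = colspace(H_{32} U_2), colspace(H_{12} U_2) = colspace(H_{13} U_3), and colspace(H_{23} U_3) = colspace(H_{21} U_1). -/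
open Matrix

/-- Right multiplication by an invertible matrix does not change the column space. -/
theorem range_mulVecLin_mul_of_isUnit_det {m n R : Type*} [Fintype n] [DecidableEq n]
    [CommRing R] (A : Matrix m n R) {B : Matrix n n R} (hB : IsUnit B.det) :
    LinearMap.range (A * B).mulVecLin = LinearMap.range A.mulVecLin := by
  rw [Matrix.mulVecLin_mul]
  refine LinearMap.range_comp_of_range_eq_top _ (LinearMap.range_eq_top.2 fun v => ?_)
  exact ⟨B⁻¹ *ᵥ v, by simp [Matrix.mul_nonsing_inv _ hB]⟩

/-- In the 3-user square MIMO IC with `M = N = 2d`, if `U₁` consists of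
eigenvector columns of `Y = H₃₁⁻¹ H₃₂ H₁₂⁻¹ H₁₃ H₂₃⁻¹ H₂₁` (i.e. `Y U₁ = U₁ Λ` with `Λ`
invertible diagonal), and `U₃ = H₂₃⁻¹ H₂₁ U₁`, `U₂ = H₁₂⁻¹ H₁₃ U₃`, then the interference
alignment conditions hold: `colspace (H₃₁ U₁) = colspace (H₃₂ U₂)`,
`colspace (H₁₂ U₂) = colspace (H₁₃ U₃)` and `colspace (H₂₃ U₃) = colspace (H₂₁ U₁)`. -/
theorem stmt_12 {d : ℕ} (hd : 1 ≤ d)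
    (H31 H32 H12 H13 H23 H21 : Matrix (Fin (2 * d)) (Fin (2 * d)) ℂ)
    (h31 : IsUnit H31.det) (h32 : IsUnit H32.det) (h12 : IsUnit H12.det)
    (h13 : IsUnit H13.det) (h23 : IsUnit H23.det) (h21 : IsUnit H21.det)
    (Y : Matrix (Fin (2 * d)) (Fin (2 * d)) ℂ)
    (hY : Y = H31⁻¹ * H32 * H12⁻¹ * H13 * H23⁻¹ * H21)
    (U1 : Matrix (Fin (2 * d)) (Fin d) ℂ)
    (Λ : Matrix (Fin d) (Fin d) ℂ) (hΛdiag : Λ.IsDiag) (hΛ : IsUnit Λ.det)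
    (hU1 : Y * U1 = U1 * Λ)
    (U3 : Matrix (Fin (2 * d)) (Fin d) ℂ) (hU3 : U3 = H23⁻¹ * H21 * U1)
    (U2 : Matrix (Fin (2 * d)) (Fin d) ℂ) (hU2 : U2 = H12⁻¹ * H13 * U3) :
    LinearMap.range (H31 * U1).mulVecLin = LinearMap.range (H32 * U2).mulVecLin ∧
    LinearMap.range (H12 * U2).mulVecLin = LinearMap.range (H13 * U3).mulVecLin ∧
    LinearMap.range (H23 * U3).mulVecLin = LinearMap.range (H21 * U1).mulVecLin := by
  have key : H32 * U2 = H31 * U1 * Λ := by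
    rw [Matrix.mul_assoc H31, ← hU1, hY, hU2, hU3]
    simp only [Matrix.mul_assoc]
    rw [Matrix.mul_nonsing_inv_cancel_left _ _ h31]
  refine ⟨?_, ?_, ?_⟩
  · rw [key, range_mulVecLin_mul_of_isUnit_det _ hΛ]
  · rw [hU2, Matrix.mul_assoc, Matrix.mul_nonsing_inv_cancel_left _ _ h12]
  · rw [hU3, Matrix.mul_assoc, Matrix.mul_nonsing_inv_cancel_left _ _ h23]
end
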